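/- Program 1-substitution: if the program typings Γ, x:A; Δ₁, x :s A ⊢ m : B and Γ; Δ₂ ⊢ n : A are derivable, the context constraint Δ₂ ▷ s holds, and the merge Δ₁ ∪̇ Δ₂ is defined, then Γ; Δ₁ ∪̇ Δ₂ ⊢ m[n/x] : B[n/x] is derivable. -/

import Mathlib

namespace TLL

/-- The two sorts of TLL: `U` (non-linear) and `L` (linear). -/
inductive Srt : Type
  | U | L
deriving DecidableEq

/-- TLL terms in de Bruijn representation: variables, sorts, the two Π-type
formers (irrelevant `pi0` and relevant `pi1`), the two λ-formers, application,
the erased constant `box`, and heap pointers `ptr`. -/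
inductive Tm : Type
  | var  : Nat → Tm
  | srt  : Srt → Tm
  | pi0  : Srt → Tm → Tm → Tm
  | pi1  : Srt → Tm → Tm → Tm
  | lam0 : Srt → Tm → Tm → Tm
  | lam1 : Srt → Tm → Tm → Tm
  | app  : Tm → Tm → Tm
  | box  : Tm
  | ptr  : Nat → Tm

def upr (ξ : Nat → Nat) : Nat → Nat
  | 0 => 0
  | n + 1 => ξ n + 1

def rename (ξ : Nat → Nat) : Tm → Tm
  | .var x => .var (ξ x)
  | .srt s => .srt s
  | .pi0 t A B => .pi0 t (rename ξ A) (rename (upr ξ) B)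
  | .pi1 t A B => .pi1 t (rename ξ A) (rename (upr ξ) B)
  | .lam0 t A m => .lam0 t (rename ξ A) (rename (upr ξ) m)
  | .lam1 t A m => .lam1 t (rename ξ A) (rename (upr ξ) m)
  | .app m n => .app (rename ξ m) (rename ξ n)
  | .box => .box
  | .ptr l => .ptr l

def up (σ : Nat → Tm) : Nat → Tm
  | 0 => .var 0
  | n + 1 => rename Nat.succ (σ n)

def subst (σ : Nat → Tm) : Tm → Tm
  | .var x => σ x
  | .srt s => .srt s
  | .pi0 t A B => .pi0 t (subst σ A) (subst (up σ) B)
  | .pi1 t A B => .pi1 t (subst σ A) (subst (up σ) B)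
  | .lam0 t A m => .lam0 t (subst σ A) (subst (up σ) m)
  | .lam1 t A m => .lam1 t (subst σ A) (subst (up σ) m)
  | .app m n => .app (subst σ m) (subst σ n)
  | .box => .box
  | .ptr l => .ptr l

/-- `subst1 n m` is `m[n/x]` for the topmost bound variable `x`. -/
def subst1 (n : Tm) (m : Tm) : Tm :=
  subst (fun i => match i with | 0 => n | i + 1 => .var i) m

/-- Logical one-step reduction `m ~> n`: full β-reduction with both β-rules,
closed under all structural subterm positions. -/
inductive LStep : Tm → Tm → Prop
  | beta0 {t A m n} : LStep (.app (.lam0 t A m) n) (subst1 n m)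
  | beta1 {t A m n} : LStep (.app (.lam1 t A m) n) (subst1 n m)
  | appL {m m' n} : LStep m m' → LStep (.app m n) (.app m' n)
  | appR {m n n'} : LStep n n' → LStep (.app m n) (.app m n')
  | pi0A {t A A' B} : LStep A A' → LStep (.pi0 t A B) (.pi0 t A' B)
  | pi0B {t A B B'} : LStep B B' → LStep (.pi0 t A B) (.pi0 t A B')
  | pi1A {t A A' B} : LStep A A' → LStep (.pi1 t A B) (.pi1 t A' B)
  | pi1B {t A B B'} : LStep B B' → LStep (.pi1 t A B) (.pi1 t A B')
  | lam0A {t A A' m} : LStep A A' → LStep (.lam0 t A m) (.lam0 t A' m)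
  | lam0M {t A m m'} : LStep m m' → LStep (.lam0 t A m) (.lam0 t A m')
  | lam1A {t A A' m} : LStep A A' → LStep (.lam1 t A m) (.lam1 t A' m)
  | lam1M {t A m m'} : LStep m m' → LStep (.lam1 t A m) (.lam1 t A m')

/-- Multi-step logical reduction. -/
abbrev LRed : Tm → Tm → Prop := Relation.ReflTransGen LStep

/-- Definitional equality `A ≃ B`: equivalence closure of logical reduction. -/
def Conv (A B : Tm) : Prop := Relation.EqvGen LStep A B

/-- Parallel logical reduction `m ⇒ n`. -/
inductive PStep : Tm → Tm → Prop
  | var {x} : PStep (.var x) (.var x)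
  | srt {s} : PStep (.srt s) (.srt s)
  | box : PStep .box .box
  | ptr {l} : PStep (.ptr l) (.ptr l)
  | pi0 {t A A' B B'} : PStep A A' → PStep B B' → PStep (.pi0 t A B) (.pi0 t A' B')
  | pi1 {t A A' B B'} : PStep A A' → PStep B B' → PStep (.pi1 t A B) (.pi1 t A' B')
  | lam0 {t A A' m m'} : PStep A A' → PStep m m' → PStep (.lam0 t A m) (.lam0 t A' m')
  | lam1 {t A A' m m'} : PStep A A' → PStep m m' → PStep (.lam1 t A m) (.lam1 t A' m')
  | app {m m' n n'} : PStep m m' → PStep n n' → PStep (.app m n) (.app m' n')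
  | beta0 {t A m m' n n'} : PStep m m' → PStep n n' →
      PStep (.app (.lam0 t A m) n) (subst1 n' m')
  | beta1 {t A m m' n n'} : PStep m m' → PStep n n' →
      PStep (.app (.lam1 t A m) n) (subst1 n' m')

/-- Logical contexts: lists of types (de Bruijn). -/
abbrev Ctx := List Tm

/-- `Has Γ x A`: variable `x` has type `A` in logical context `Γ`
(with the appropriate de Bruijn shifts). -/
inductive Has : Ctx → Nat → Tm → Prop
  | zero {Γ A} : Has (A :: Γ) 0 (rename Nat.succ A)
  | succ {Γ x A B} : Has Γ x A → Has (B :: Γ) (x + 1) (rename Nat.succ A)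

mutual
/-- Well-formed logical contexts. -/
inductive LWf : Ctx → Prop
  | nil : LWf []
  | cons {Γ A s} : LWf Γ → LTyped Γ A (.srt s) → LWf (A :: Γ)

/-- The logical typing judgment `Γ ⊢ m : A`. -/
inductive LTyped : Ctx → Tm → Tm → Prop
  | srt {Γ} (s : Srt) : LWf Γ → LTyped Γ (.srt s) (.srt .U)
  | var {Γ x A} : LWf Γ → Has Γ x A → LTyped Γ (.var x) A
  | pi0 {Γ A B s r} (t : Srt) :
      LTyped Γ A (.srt s) → LTyped (A :: Γ) B (.srt r) →
      LTyped Γ (.pi0 t A B) (.srt t)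
  | pi1 {Γ A B s r} (t : Srt) :
      LTyped Γ A (.srt s) → LTyped (A :: Γ) B (.srt r) →
      LTyped Γ (.pi1 t A B) (.srt t)
  | lam0 {Γ A B m} (t : Srt) :
      LTyped (A :: Γ) m B → LTyped Γ (.lam0 t A m) (.pi0 t A B)
  | lam1 {Γ A B m} (t : Srt) :
      LTyped (A :: Γ) m B → LTyped Γ (.lam1 t A m) (.pi1 t A B)
  | app0 {Γ m n A B t} :
      LTyped Γ m (.pi0 t A B) → LTyped Γ n A → LTyped Γ (.app m n) (subst1 n B)
  | app1 {Γ m n A B t} :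
      LTyped Γ m (.pi1 t A B) → LTyped Γ n A → LTyped Γ (.app m n) (subst1 n B)
  | conv {Γ m A B s} :
      LTyped Γ m A → LTyped Γ B (.srt s) → Conv A B → LTyped Γ m B
end

/-- Program context entries: either absent, or a sort-annotated type. -/
abbrev Entry := Option (Srt × Tm)

/-- Program contexts, positionally aligned with the logical context. -/
abbrev PCtx := List Entry

/-- The context constraint `Δ ▷ s`. -/
inductive Restr : PCtx → Srt → Prop
  | nil {s} : Restr [] s
  | skip {Δ s} : Restr Δ s → Restr ((none : Entry) :: Δ) s
  | u {Δ A} : Restr Δ .U → Restr (some (.U, A) :: Δ) .U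
  | l {Δ s A} : Restr Δ .L → Restr (some (s, A) :: Δ) .L

/-- Context merge `Δ₁ ∪̇ Δ₂ = Δ`: contraction on shared `U` entries,
`L` entries occur on exactly one side. -/
inductive Merge : PCtx → PCtx → PCtx → Prop
  | nil : Merge [] [] []
  | contra {Δ₁ Δ₂ Δ A} : Merge Δ₁ Δ₂ Δ →
      Merge (some (.U, A) :: Δ₁) (some (.U, A) :: Δ₂) (some (.U, A) :: Δ)
  | left {Δ₁ Δ₂ Δ A} : Merge Δ₁ Δ₂ Δ →
      Merge (some (.L, A) :: Δ₁) ((none : Entry) :: Δ₂) (some (.L, A) :: Δ)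
  | right {Δ₁ Δ₂ Δ A} : Merge Δ₁ Δ₂ Δ →
      Merge ((none : Entry) :: Δ₁) (some (.L, A) :: Δ₂) (some (.L, A) :: Δ)
  | skip {Δ₁ Δ₂ Δ} : Merge Δ₁ Δ₂ Δ →
      Merge ((none : Entry) :: Δ₁) ((none : Entry) :: Δ₂) ((none : Entry) :: Δ)

/-- `PHas Δ x s A`: the entry `x :s A` occurs in `Δ` and the rest of `Δ`
satisfies `▷ U` (so no linear entry is discarded). -/
inductive PHas : PCtx → Nat → Srt → Tm → Prop
  | zero {Δ s A} : Restr Δ .U → PHas (some (s, A) :: Δ) 0 s (rename Nat.succ A)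
  | succN {Δ x s A} : PHas Δ x s A → PHas ((none : Entry) :: Δ) (x + 1) s (rename Nat.succ A)
  | succU {Δ x s A B} : PHas Δ x s A → PHas (some (.U, B) :: Δ) (x + 1) s (rename Nat.succ A)

/-- Well-formed pairs of logical and program contexts `Γ ; Δ ⊢`. -/
inductive PWf : Ctx → PCtx → Prop
  | nil : PWf [] []
  | cons {Γ Δ A s} : PWf Γ Δ → LTyped Γ A (.srt s) → PWf (A :: Γ) (some (s, A) :: Δ)
  | consN {Γ Δ A s} : PWf Γ Δ → LTyped Γ A (.srt s) → PWf (A :: Γ) ((none : Entry) :: Δ)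

/-- The program typing judgment `Γ ; Δ ⊢ m : A`. -/
inductive PTyped : Ctx → PCtx → Tm → Tm → Prop
  | var {Γ Δ x s A} : PWf Γ Δ → PHas Δ x s A → PTyped Γ Δ (.var x) A
  | lam0 {Γ Δ A B m} (t : Srt) :
      PTyped (A :: Γ) ((none : Entry) :: Δ) m B → Restr Δ t →
      PTyped Γ Δ (.lam0 t A m) (.pi0 t A B)
  | lam1 {Γ Δ A B m s} (t : Srt) :
      PTyped (A :: Γ) (some (s, A) :: Δ) m B → Restr Δ t →
      PTyped Γ Δ (.lam1 t A m) (.pi1 t A B)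
  | app0 {Γ Δ m n A B t} :
      PTyped Γ Δ m (.pi0 t A B) → LTyped Γ n A →
      PTyped Γ Δ (.app m n) (subst1 n B)
  | app1 {Γ Δ₁ Δ₂ Δ m n A B t} :
      PTyped Γ Δ₁ m (.pi1 t A B) → PTyped Γ Δ₂ n A → Merge Δ₁ Δ₂ Δ →
      PTyped Γ Δ (.app m n) (subst1 n B)
  | conv {Γ Δ m A B s} :
      PTyped Γ Δ m A → LTyped Γ B (.srt s) → Conv A B →
      PTyped Γ Δ m B

/-- Program values. -/
inductive Value : Tm → Prop
  | var {x} : Value (.var x)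
  | lam0 {t A m} : Value (.lam0 t A m)
  | lam1 {t A m} : Value (.lam1 t A m)

/-- Program (call-by-value) one-step reduction `m ~~> n`. -/
inductive CStep : Tm → Tm → Prop
  | appL {m m' n} : CStep m m' → CStep (.app m n) (.app m' n)
  | appR {m n n'} : CStep n n' → CStep (.app m n) (.app m n')
  | beta0 {t A m n} : CStep (.app (.lam0 t A m) n) (subst1 n m)
  | beta1 {t A m v} : Value v → CStep (.app (.lam1 t A m) v) (subst1 v m)

/-- The erasure judgment `Γ ; Δ ⊢ m ~ m' : A`. -/
inductive Erase : Ctx → PCtx → Tm → Tm → Tm → Prop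
  | var {Γ Δ x s A} : PWf Γ Δ → PHas Δ x s A → Erase Γ Δ (.var x) (.var x) A
  | lam0 {Γ Δ A B m m'} (t : Srt) :
      Erase (A :: Γ) ((none : Entry) :: Δ) m m' B → Restr Δ t →
      Erase Γ Δ (.lam0 t A m) (.lam0 t .box m') (.pi0 t A B)
  | lam1 {Γ Δ A B m m' s} (t : Srt) :
      Erase (A :: Γ) (some (s, A) :: Δ) m m' B → Restr Δ t →
      Erase Γ Δ (.lam1 t A m) (.lam1 t .box m') (.pi1 t A B)
  | app0 {Γ Δ m m' n A B t} :
      Erase Γ Δ m m' (.pi0 t A B) → LTyped Γ n A →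
      Erase Γ Δ (.app m n) (.app m' .box) (subst1 n B)
  | app1 {Γ Δ₁ Δ₂ Δ m m' n n' A B t} :
      Erase Γ Δ₁ m m' (.pi1 t A B) → Erase Γ Δ₂ n n' A → Merge Δ₁ Δ₂ Δ →
      Erase Γ Δ (.app m n) (.app m' n') (subst1 n B)
  | conv {Γ Δ m m' A B s} :
      Erase Γ Δ m m' A → LTyped Γ B (.srt s) → Conv A B →
      Erase Γ Δ m m' B

/-- Heaps: finite maps from locations to sort-annotated values. -/
abbrev Heap := Nat → Option (Srt × Tm)

/-- Heap lookup `Lookup H₁ l v H₂`: non-linear cells persist, linear cells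
are deallocated. -/
inductive Lookup : Heap → Nat → Tm → Heap → Prop
  | u {H l v} : H l = some (.U, v) → Lookup H l v H
  | l {H l v} : H l = some (.L, v) → Lookup H l v (Function.update H l none)

/-- Heap merge `H₁ ∪̇ H₂ = H`. -/
def HMerge (H₁ H₂ H : Heap) : Prop := ∀ l,
  (H₁ l = none ∧ H₂ l = none ∧ H l = none) ∨
  (∃ v, H₁ l = some (.U, v) ∧ H₂ l = some (.U, v) ∧ H l = some (.U, v)) ∨
  (∃ v, H₁ l = some (.L, v) ∧ H₂ l = none ∧ H l = some (.L, v)) ∨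
  (∃ v, H₁ l = none ∧ H₂ l = some (.L, v) ∧ H l = some (.L, v))

/-- The heap constraint `H ▷ s`. -/
def HRestr (H : Heap) : Srt → Prop
  | .U => ∀ l s v, H l = some (s, v) → s = Srt.U
  | .L => True

/-- Heap reduction `H ; m ~~> H' ; m'`. -/
inductive HStep : Heap → Tm → Heap → Tm → Prop
  | alloc0 {H l t m} : H l = none →
      HStep H (.lam0 t .box m) (Function.update H l (some (t, .lam0 t .box m))) (.ptr l)
  | alloc1 {H l t m} : H l = none →
      HStep H (.lam1 t .box m) (Function.update H l (some (t, .lam1 t .box m))) (.ptr l)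
  | appL {H H' m m' n} : HStep H m H' m' → HStep H (.app m n) H' (.app m' n)
  | appR {H H' m n n'} : HStep H n H' n' → HStep H (.app m n) H' (.app m n')
  | beta0 {H H' l t m n} : Lookup H l (.lam0 t .box m) H' →
      HStep H (.app (.ptr l) n) H' (subst1 .box m)
  | beta1 {H H' l₁ l₂ t m} : Lookup H l₁ (.lam1 t .box m) H' →
      HStep H (.app (.ptr l₁) (.ptr l₂)) H' (subst1 (.ptr l₂) m)

/-- Pointer resolution `H ; m ~ n`. -/
inductive Resolve : Heap → Tm → Tm → Prop
  | var {H x} : HRestr H .U → Resolve H (.var x) (.var x)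
  | lam0 {H t m' m} : HRestr H t → Resolve H m' m →
      Resolve H (.lam0 t .box m') (.lam0 t .box m)
  | lam1 {H t m' m} : HRestr H t → Resolve H m' m →
      Resolve H (.lam1 t .box m') (.lam1 t .box m)
  | app0 {H m' m} : Resolve H m' m → Resolve H (.app m' .box) (.app m .box)
  | app1 {H₁ H₂ H m' m n' n} : HMerge H₁ H₂ H →
      Resolve H₁ m' m → Resolve H₂ n' n → Resolve H (.app m' n') (.app m n)
  | ptr {H H' l v' v} : Lookup H l v' H' → Resolve H' v' v → Resolve H (.ptr l) v

/-- `ClosedUnder k m`: all free de Bruijn variables of `m` are `< k`. -/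
def ClosedUnder : Nat → Tm → Prop
  | k, .var x => x < k
  | _, .srt _ => True
  | k, .pi0 _ A B => ClosedUnder k A ∧ ClosedUnder (k + 1) B
  | k, .pi1 _ A B => ClosedUnder k A ∧ ClosedUnder (k + 1) B
  | k, .lam0 _ A m => ClosedUnder k A ∧ ClosedUnder (k + 1) m
  | k, .lam1 _ A m => ClosedUnder k A ∧ ClosedUnder (k + 1) m
  | k, .app m n => ClosedUnder k m ∧ ClosedUnder k n
  | _, .box => True
  | _, .ptr _ => True

/-- WR-heaps: heaps plausibly produced by heap reduction. -/
inductive WrHeap : Heap → Prop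
  | nil : WrHeap (fun _ => none)
  | lam0 {H l t m} : ClosedUnder 1 m → WrHeap H → H l = none →
      WrHeap (Function.update H l (some (t, .lam0 t .box m)))
  | lam1 {H l t m} : ClosedUnder 1 m → WrHeap H → H l = none →
      WrHeap (Function.update H l (some (t, .lam1 t .box m)))

/-- Well-resolved `H ⊢ a ~ b ~ c : A`. -/
def WellResolved (H : Heap) (a b c A : Tm) : Prop :=
  Erase [] [] a b A ∧ Resolve H c b


/-! ### Algebra of renamings and substitutions -/

/-- The substitution sending the topmost variable to `n` and lowering the others. -/
def inst (n : Tm) : Nat → Tm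
  | 0 => n
  | i + 1 => .var i

theorem subst1_eq (n m : Tm) : subst1 n m = subst (inst n) m :=
  rfl

theorem up_var_comp (ξ : Nat → Nat) :
    up (fun x => .var (ξ x)) = fun x => .var (upr ξ x) := by
  funext x
  cases x <;> rfl

theorem rename_eq_subst (m : Tm) (ξ : Nat → Nat) :
    rename ξ m = subst (fun x => .var (ξ x)) m := by
  induction m generalizing ξ <;> simp_all [rename, subst, up_var_comp]

theorem up_comp_upr (σ : Nat → Tm) (ξ : Nat → Nat) :
    (fun x => up σ (upr ξ x)) = up (fun x => σ (ξ x)) := by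
  funext x
  cases x <;> rfl

theorem subst_rename (m : Tm) (σ : Nat → Tm) (ξ : Nat → Nat) :
    subst σ (rename ξ m) = subst (fun x => σ (ξ x)) m := by
  induction m generalizing σ ξ <;> simp_all [rename, subst, up_comp_upr]

theorem rename_rename (m : Tm) (ξ ζ : Nat → Nat) :
    rename ζ (rename ξ m) = rename (fun x => ζ (ξ x)) m := by
  rw [rename_eq_subst, subst_rename, rename_eq_subst]

theorem rename_upr_succ (m : Tm) (ξ : Nat → Nat) :
    rename (upr ξ) (rename Nat.succ m) = rename Nat.succ (rename ξ m) := by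
  simp only [rename_rename]
  rfl

theorem upr_comp_up (σ : Nat → Tm) (ξ : Nat → Nat) :
    (fun x => rename (upr ξ) (up σ x)) = up (fun x => rename ξ (σ x)) := by
  funext x
  cases x
  · rfl
  · exact rename_upr_succ _ _

theorem rename_subst (m : Tm) (σ : Nat → Tm) (ξ : Nat → Nat) :
    rename ξ (subst σ m) = subst (fun x => rename ξ (σ x)) m := by
  induction m generalizing σ ξ <;> simp_all [rename, subst, upr_comp_up]

theorem subst_up_succ (m : Tm) (σ : Nat → Tm) :
    subst (up σ) (rename Nat.succ m) = rename Nat.succ (subst σ m) := by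
  rw [subst_rename, rename_subst]
  rfl

theorem up_comp_up (σ τ : Nat → Tm) :
    (fun x => subst (up τ) (up σ x)) = up (fun x => subst τ (σ x)) := by
  funext x
  cases x
  · rfl
  · exact subst_up_succ _ _

theorem subst_subst (m : Tm) (σ τ : Nat → Tm) :
    subst τ (subst σ m) = subst (fun x => subst τ (σ x)) m := by
  induction m generalizing σ τ <;> simp_all [subst, up_comp_up]

theorem up_var : up Tm.var = Tm.var := by
  funext x
  cases x <;> rfl

theorem subst_var (m : Tm) : subst Tm.var m = m := by
  induction m <;> simp_all [subst, up_var]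

theorem subst_inst_succ (n m : Tm) : subst (inst n) (rename Nat.succ m) = m := by
  rw [subst_rename]
  exact subst_var m

theorem subst_subst1 (σ : Nat → Tm) (n m : Tm) :
    subst σ (subst1 n m) = subst1 (subst σ n) (subst (up σ) m) := by
  simp only [subst1_eq, subst_subst]
  congr 1
  funext x
  cases x
  · rfl
  · exact (subst_inst_succ _ _).symm

theorem rename_subst1 (ξ : Nat → Nat) (n m : Tm) :
    rename ξ (subst1 n m) = subst1 (rename ξ n) (rename (upr ξ) m) := by
  simp only [rename_eq_subst, subst_subst1, up_var_comp]

/-! ### Definitional equality is stable under substitution -/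

theorem LStep.subst {m n : Tm} (h : LStep m n) (σ : Nat → Tm) :
    LStep (subst σ m) (subst σ n) := by
  induction h generalizing σ with
  | beta0 => rw [subst_subst1]; exact .beta0
  | beta1 => rw [subst_subst1]; exact .beta1
  | appL _ ih => exact .appL (ih σ)
  | appR _ ih => exact .appR (ih σ)
  | pi0A _ ih => exact .pi0A (ih σ)
  | pi0B _ ih => exact .pi0B (ih _)
  | pi1A _ ih => exact .pi1A (ih σ)
  | pi1B _ ih => exact .pi1B (ih _)
  | lam0A _ ih => exact .lam0A (ih σ)
  | lam0M _ ih => exact .lam0M (ih _)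
  | lam1A _ ih => exact .lam1A (ih σ)
  | lam1M _ ih => exact .lam1M (ih _)

theorem Conv.subst {A B : Tm} (h : Conv A B) (σ : Nat → Tm) :
    Conv (subst σ A) (subst σ B) := by
  induction h with
  | rel _ _ h => exact .rel _ _ (h.subst σ)
  | refl => exact .refl _
  | symm _ _ _ ih => exact .symm _ _ ih
  | trans _ _ _ _ _ ih₁ ih₂ => exact .trans _ _ _ ih₁ ih₂

theorem Conv.rename {A B : Tm} (h : Conv A B) (ξ : Nat → Nat) :
    Conv (rename ξ A) (rename ξ B) := by
  simpa only [rename_eq_subst] using h.subst _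

/-! ### Logical weakening -/

/-- Renamings that insert one well-formed type into a logical context. -/
inductive LRen : Ctx → (Nat → Nat) → Ctx → Prop
  | base {Γ B s} : LTyped Γ B (.srt s) → LRen Γ Nat.succ (B :: Γ)
  | lift {Γ Γ' ξ} (A : Tm) : LRen Γ ξ Γ' → LRen (A :: Γ) (upr ξ) (rename ξ A :: Γ')

theorem LRen.has {Γ Γ' : Ctx} {ξ : Nat → Nat} (h : LRen Γ ξ Γ') {x : Nat} {A : Tm}
    (hx : Has Γ x A) : Has Γ' (ξ x) (rename ξ A) := by
  induction h generalizing x A with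
  | base => exact .succ hx
  | lift B _ ih =>
    cases hx with
    | zero => rw [rename_upr_succ]; exact .zero
    | succ hx => rw [rename_upr_succ]; exact .succ (ih hx)

mutual
theorem LWf.rename {Γ Γ' : Ctx} {ξ : Nat → Nat} (h : LWf Γ) (hξ : LRen Γ ξ Γ') : LWf Γ' :=
  match h, hξ with
  | .nil, .base hB => .cons .nil hB
  | .cons hΓ hA, .base hB => .cons (.cons hΓ hA) hB
  | .cons hΓ hA, .lift _ hξ => .cons (hΓ.rename hξ) (hA.rename hξ)

theorem LTyped.rename {Γ Γ' : Ctx} {ξ : Nat → Nat} {m A : Tm} (h : LTyped Γ m A)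
    (hξ : LRen Γ ξ Γ') : LTyped Γ' (rename ξ m) (rename ξ A) :=
  match h with
  | .srt s hΓ => .srt s (hΓ.rename hξ)
  | .var hΓ hx => .var (hΓ.rename hξ) (hξ.has hx)
  | .pi0 t hA hB => .pi0 t (hA.rename hξ) (hB.rename (.lift _ hξ))
  | .pi1 t hA hB => .pi1 t (hA.rename hξ) (hB.rename (.lift _ hξ))
  | .lam0 t hm => .lam0 t (hm.rename (.lift _ hξ))
  | .lam1 t hm => .lam1 t (hm.rename (.lift _ hξ))
  | .app0 hm hn => rename_subst1 ξ _ _ ▸ .app0 (hm.rename hξ) (hn.rename hξ)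
  | .app1 hm hn => rename_subst1 ξ _ _ ▸ .app1 (hm.rename hξ) (hn.rename hξ)
  | .conv hm hB hc => .conv (hm.rename hξ) (hB.rename hξ) (hc.rename ξ)
end

/-! ### Logical substitution -/

/-- Substitutions that eliminate one variable of a logical context. -/
inductive LSub : Ctx → (Nat → Tm) → Ctx → Prop
  | base {Γ n A} : LTyped Γ n A → LSub (A :: Γ) (inst n) Γ
  | lift {Γ Γ' σ} (A : Tm) : LSub Γ σ Γ' → LSub (A :: Γ) (up σ) (subst σ A :: Γ')

theorem LSub.has {Γ Γ' : Ctx} {σ : Nat → Tm} (h : LSub Γ σ Γ') (hΓ : LWf Γ') {x : Nat}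
    {A : Tm} (hx : Has Γ x A) : LTyped Γ' (σ x) (subst σ A) := by
  induction h generalizing x A with
  | base hn =>
    cases hx with
    | zero => rw [subst_inst_succ]; exact hn
    | succ hx => rw [subst_inst_succ]; exact .var hΓ hx
  | lift B _ ih =>
    cases hx with
    | zero => rw [subst_up_succ]; exact .var hΓ .zero
    | succ hx =>
      rw [subst_up_succ]
      cases hΓ with
      | cons hΓ hB => exact (ih hΓ hx).rename (.base hB)

mutual
theorem LWf.subst {Γ Γ' : Ctx} {σ : Nat → Tm} (h : LWf Γ) (hσ : LSub Γ σ Γ') : LWf Γ' :=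
  match h, hσ with
  | .cons hΓ _, .base _ => hΓ
  | .cons hΓ hA, .lift _ hσ => .cons (hΓ.subst hσ) (hA.subst hσ)

theorem LTyped.subst {Γ Γ' : Ctx} {σ : Nat → Tm} {m A : Tm} (h : LTyped Γ m A)
    (hσ : LSub Γ σ Γ') : LTyped Γ' (subst σ m) (subst σ A) :=
  match h with
  | .srt s hΓ => .srt s (hΓ.subst hσ)
  | .var hΓ hx => hσ.has (hΓ.subst hσ) hx
  | .pi0 t hA hB => .pi0 t (hA.subst hσ) (hB.subst (.lift _ hσ))
  | .pi1 t hA hB => .pi1 t (hA.subst hσ) (hB.subst (.lift _ hσ))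
  | .lam0 t hm => .lam0 t (hm.subst (.lift _ hσ))
  | .lam1 t hm => .lam1 t (hm.subst (.lift _ hσ))
  | .app0 hm hn => subst_subst1 σ _ _ ▸ .app0 (hm.subst hσ) (hn.subst hσ)
  | .app1 hm hn => subst_subst1 σ _ _ ▸ .app1 (hm.subst hσ) (hn.subst hσ)
  | .conv hm hB hc => .conv (hm.subst hσ) (hB.subst hσ) (hc.subst σ)
end

/-! ### Constraints and merges of program contexts -/

theorem Restr.linear (Δ : PCtx) : Restr Δ .L := by
  induction Δ with
  | nil => exact .nil
  | cons e Δ ih =>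
    rcases e with _ | ⟨s, A⟩
    · exact .skip ih
    · exact .l ih

theorem Restr.cons_nonlinear {Δ : PCtx} {t : Srt} (h : Restr Δ t) (A : Tm) :
    Restr (some (.U, A) :: Δ) t := by
  cases t
  · exact .u h
  · exact .l h

theorem Merge.symm {Δ₁ Δ₂ Δ : PCtx} (h : Merge Δ₁ Δ₂ Δ) : Merge Δ₂ Δ₁ Δ := by
  induction h with
  | nil => exact .nil
  | contra _ ih => exact .contra ih
  | left _ ih => exact .right ih
  | right _ ih => exact .left ih
  | skip _ ih => exact .skip ih

theorem Merge.eq_left {Δ₁ Δ₂ Δ : PCtx} (h : Merge Δ₁ Δ₂ Δ) (hr : Restr Δ₂ .U) :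
    Δ = Δ₁ := by
  induction h with
  | nil => rfl
  | contra _ ih => cases hr with | u hr => rw [ih hr]
  | left _ ih => cases hr with | skip hr => rw [ih hr]
  | right => cases hr
  | skip _ ih => cases hr with | skip hr => rw [ih hr]

theorem Merge.eq_right {Δ₁ Δ₂ Δ : PCtx} (h : Merge Δ₁ Δ₂ Δ) (hr : Restr Δ₁ .U) :
    Δ = Δ₂ :=
  h.symm.eq_left hr

/-- A non-linear context that merges with a merge merges with each of its parts. -/
theorem Merge.absorb_left {Δa Δb Δ₁ Δ₂ Δ : PCtx} (h : Merge Δa Δb Δ₁) (h' : Merge Δ₁ Δ₂ Δ)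
    (hr : Restr Δ₂ .U) : Merge Δa Δ₂ Δa := by
  induction h generalizing Δ₂ Δ with
  | nil => cases h'; exact .nil
  | contra _ ih => cases h' with | contra h' => cases hr with | u hr => exact .contra (ih h' hr)
  | left _ ih => cases h' with | left h' => cases hr with | skip hr => exact .left (ih h' hr)
  | right _ ih => cases h' with | left h' => cases hr with | skip hr => exact .skip (ih h' hr)
  | skip _ ih =>
    cases h' with
    | right => cases hr
    | skip h' => cases hr with | skip hr => exact .skip (ih h' hr)

theorem Merge.right_comm {Δa Δb Δ₁ Δ₂ Δ : PCtx} (h : Merge Δa Δb Δ₁) (h' : Merge Δ₁ Δ₂ Δ) :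
    ∃ Δa', Merge Δa Δ₂ Δa' ∧ Merge Δa' Δb Δ := by
  induction h generalizing Δ₂ Δ with
  | nil => cases h'; exact ⟨_, .nil, .nil⟩
  | contra _ ih =>
    cases h' with
    | contra h' => obtain ⟨_, h₁, h₂⟩ := ih h'; exact ⟨_, .contra h₁, .contra h₂⟩
  | left _ ih =>
    cases h' with
    | left h' => obtain ⟨_, h₁, h₂⟩ := ih h'; exact ⟨_, .left h₁, .left h₂⟩
  | right _ ih =>
    cases h' with
    | left h' => obtain ⟨_, h₁, h₂⟩ := ih h'; exact ⟨_, .skip h₁, .right h₂⟩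
  | skip _ ih =>
    cases h' with
    | right h' => obtain ⟨_, h₁, h₂⟩ := ih h'; exact ⟨_, .right h₁, .left h₂⟩
    | skip h' => obtain ⟨_, h₁, h₂⟩ := ih h'; exact ⟨_, .skip h₁, .skip h₂⟩

/-! ### Program typing and well-formedness -/

theorem PWf.merge {Γ : Ctx} {Δ₁ Δ₂ Δ : PCtx} (hm : Merge Δ₁ Δ₂ Δ) (h₁ : PWf Γ Δ₁)
    (h₂ : PWf Γ Δ₂) : PWf Γ Δ := by
  induction hm generalizing Γ with
  | nil => exact h₁
  | contra _ ih =>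
    cases h₁ with
    | cons h₁ hA => cases h₂ with | cons h₂ _ => exact .cons (ih h₁ h₂) hA
  | left _ ih =>
    cases h₁ with
    | cons h₁ hA => cases h₂ with | consN h₂ _ => exact .cons (ih h₁ h₂) hA
  | right _ ih =>
    cases h₁ with
    | consN h₁ _ => cases h₂ with | cons h₂ hA => exact .cons (ih h₁ h₂) hA
  | skip _ ih =>
    cases h₁ with
    | consN h₁ hA => cases h₂ with | consN h₂ _ => exact .consN (ih h₁ h₂) hA

theorem PWf.toLWf {Γ : Ctx} {Δ : PCtx} (h : PWf Γ Δ) : LWf Γ := by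
  induction h with
  | nil => exact .nil
  | cons _ hA ih => exact .cons ih hA
  | consN _ hA ih => exact .cons ih hA

theorem PHas.toHas {Γ : Ctx} {Δ : PCtx} {x : Nat} {s : Srt} {A : Tm} (hx : PHas Δ x s A)
    (h : PWf Γ Δ) : Has Γ x A := by
  induction hx generalizing Γ with
  | zero => cases h; exact .zero
  | succN _ ih => cases h with | consN h _ => exact .succ (ih h)
  | succU _ ih => cases h with | cons h _ => exact .succ (ih h)

theorem PTyped.toPWf {Γ : Ctx} {Δ : PCtx} {m A : Tm} (h : PTyped Γ Δ m A) : PWf Γ Δ := by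
  induction h with
  | var h _ => exact h
  | lam0 _ _ _ ih => cases ih; assumption
  | lam1 _ _ _ ih => cases ih; assumption
  | app0 _ _ ih => exact ih
  | app1 _ _ hm ih₁ ih₂ => exact .merge hm ih₁ ih₂
  | conv _ _ _ ih => exact ih

theorem PTyped.toLTyped {Γ : Ctx} {Δ : PCtx} {m A : Tm} (h : PTyped Γ Δ m A) :
    LTyped Γ m A := by
  induction h with
  | var h hx => exact .var h.toLWf (hx.toHas h)
  | lam0 t _ _ ih => exact .lam0 t ih
  | lam1 t _ _ ih => exact .lam1 t ih
  | app0 _ hn ih => exact .app0 ih hn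
  | app1 _ _ _ ih₁ ih₂ => exact .app1 ih₁ ih₂
  | conv _ hB hc ih => exact .conv ih hB hc

/-! ### Program weakening -/

/-- Renamings that insert one absent or non-linear entry into a program context. -/
inductive PRen : Ctx → PCtx → (Nat → Nat) → Ctx → PCtx → Prop
  | absent {Γ Δ B s} : LTyped Γ B (.srt s) → PRen Γ Δ Nat.succ (B :: Γ) ((none : Entry) :: Δ)
  | nonlinear {Γ Δ B} : LTyped Γ B (.srt .U) →
      PRen Γ Δ Nat.succ (B :: Γ) (some (.U, B) :: Δ)
  | lift {Γ Δ Γ' Δ' ξ} (s : Srt) (A : Tm) : PRen Γ Δ ξ Γ' Δ' →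
      PRen (A :: Γ) (some (s, A) :: Δ) (upr ξ) (rename ξ A :: Γ') (some (s, rename ξ A) :: Δ')
  | liftN {Γ Δ Γ' Δ' ξ} (A : Tm) : PRen Γ Δ ξ Γ' Δ' →
      PRen (A :: Γ) ((none : Entry) :: Δ) (upr ξ) (rename ξ A :: Γ') ((none : Entry) :: Δ')

theorem PRen.toLRen {Γ Γ' : Ctx} {Δ Δ' : PCtx} {ξ : Nat → Nat} (h : PRen Γ Δ ξ Γ' Δ') :
    LRen Γ ξ Γ' := by
  induction h with
  | absent hB => exact .base hB
  | nonlinear hB => exact .base hB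
  | lift _ A _ ih => exact .lift A ih
  | liftN A _ ih => exact .lift A ih

theorem PRen.pwf {Γ Γ' : Ctx} {Δ Δ' : PCtx} {ξ : Nat → Nat} (h : PRen Γ Δ ξ Γ' Δ')
    (hΔ : PWf Γ Δ) : PWf Γ' Δ' := by
  induction h with
  | absent hB => exact .consN hΔ hB
  | nonlinear hB => exact .cons hΔ hB
  | lift _ A h ih => cases hΔ with | cons hΔ hA => exact .cons (ih hΔ) (hA.rename h.toLRen)
  | liftN A h ih => cases hΔ with | consN hΔ hA => exact .consN (ih hΔ) (hA.rename h.toLRen)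

theorem PRen.restr {Γ Γ' : Ctx} {Δ Δ' : PCtx} {ξ : Nat → Nat} (h : PRen Γ Δ ξ Γ' Δ')
    {t : Srt} (hr : Restr Δ t) : Restr Δ' t := by
  induction h with
  | absent => exact .skip hr
  | nonlinear => exact hr.cons_nonlinear _
  | lift _ A _ ih =>
    cases hr with
    | u hr => exact .u (ih hr)
    | l hr => exact .l (ih hr)
  | liftN A _ ih => cases hr with | skip hr => exact .skip (ih hr)

theorem PRen.has {Γ Γ' : Ctx} {Δ Δ' : PCtx} {ξ : Nat → Nat} (h : PRen Γ Δ ξ Γ' Δ')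
    {x : Nat} {s : Srt} {A : Tm} (hx : PHas Δ x s A) : PHas Δ' (ξ x) s (rename ξ A) := by
  induction h generalizing x A with
  | absent => exact .succN hx
  | nonlinear => exact .succU hx
  | lift _ B h ih =>
    cases hx with
    | zero hr => rw [rename_upr_succ]; exact .zero (h.restr hr)
    | succU hx => rw [rename_upr_succ]; exact .succU (ih hx)
  | liftN B _ ih =>
    cases hx with
    | succN hx => rw [rename_upr_succ]; exact .succN (ih hx)

theorem PRen.split {Γ Γ' : Ctx} {Δ Δ' Δa Δb : PCtx} {ξ : Nat → Nat} (h : PRen Γ Δ ξ Γ' Δ')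
    (hm : Merge Δa Δb Δ) :
    ∃ Δa' Δb', Merge Δa' Δb' Δ' ∧ PRen Γ Δa ξ Γ' Δa' ∧ PRen Γ Δb ξ Γ' Δb' := by
  induction h generalizing Δa Δb with
  | absent hB => exact ⟨_, _, .skip hm, .absent hB, .absent hB⟩
  | nonlinear hB => exact ⟨_, _, .contra hm, .nonlinear hB, .nonlinear hB⟩
  | lift _ A _ ih =>
    cases hm with
    | contra hm =>
      obtain ⟨_, _, hm', ha, hb⟩ := ih hm
      exact ⟨_, _, .contra hm', .lift _ _ ha, .lift _ _ hb⟩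
    | left hm =>
      obtain ⟨_, _, hm', ha, hb⟩ := ih hm
      exact ⟨_, _, .left hm', .lift _ _ ha, .liftN _ hb⟩
    | right hm =>
      obtain ⟨_, _, hm', ha, hb⟩ := ih hm
      exact ⟨_, _, .right hm', .liftN _ ha, .lift _ _ hb⟩
  | liftN A _ ih =>
    cases hm with
    | skip hm =>
      obtain ⟨_, _, hm', ha, hb⟩ := ih hm
      exact ⟨_, _, .skip hm', .liftN _ ha, .liftN _ hb⟩

theorem PTyped.rename {Γ Γ' : Ctx} {Δ Δ' : PCtx} {ξ : Nat → Nat} {m A : Tm}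
    (h : PTyped Γ Δ m A) (hξ : PRen Γ Δ ξ Γ' Δ') :
    PTyped Γ' Δ' (rename ξ m) (rename ξ A) := by
  induction h generalizing Γ' Δ' ξ with
  | var h hx => exact .var (hξ.pwf h) (hξ.has hx)
  | lam0 t _ hr ih => exact .lam0 t (ih (.liftN _ hξ)) (hξ.restr hr)
  | lam1 t _ hr ih => exact .lam1 t (ih (.lift _ _ hξ)) (hξ.restr hr)
  | app0 _ hn ih => rw [rename_subst1]; exact .app0 (ih hξ) (hn.rename hξ.toLRen)
  | app1 _ _ hm ih₁ ih₂ =>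
    obtain ⟨_, _, hm', ha, hb⟩ := hξ.split hm
    rw [rename_subst1]
    exact .app1 (ih₁ ha) (ih₂ hb) hm'
  | conv _ hB hc ih => exact .conv (ih hξ) (hB.rename hξ.toLRen) (hc.rename ξ)

/-! ### Program substitution -/

/-- Substitutions that eliminate one (absent or present) entry of a program context. -/
inductive PSub : Ctx → PCtx → (Nat → Tm) → Ctx → PCtx → Prop
  | absent {Γ Δ n A} : LTyped Γ n A → PSub (A :: Γ) ((none : Entry) :: Δ) (inst n) Γ Δ
  | present {Γ Δ₁ Δ₂ Δ n A s} : PTyped Γ Δ₂ n A → Restr Δ₂ s → Merge Δ₁ Δ₂ Δ →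
      PSub (A :: Γ) (some (s, A) :: Δ₁) (inst n) Γ Δ
  | lift {Γ Δ Γ' Δ' σ} (s : Srt) (A : Tm) : PSub Γ Δ σ Γ' Δ' →
      PSub (A :: Γ) (some (s, A) :: Δ) (up σ) (subst σ A :: Γ') (some (s, subst σ A) :: Δ')
  | liftN {Γ Δ Γ' Δ' σ} (A : Tm) : PSub Γ Δ σ Γ' Δ' →
      PSub (A :: Γ) ((none : Entry) :: Δ) (up σ) (subst σ A :: Γ') ((none : Entry) :: Δ')

theorem PSub.toLSub {Γ Γ' : Ctx} {Δ Δ' : PCtx} {σ : Nat → Tm} (h : PSub Γ Δ σ Γ' Δ') :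
    LSub Γ σ Γ' := by
  induction h with
  | absent hn => exact .base hn
  | present hn => exact .base hn.toLTyped
  | lift _ A _ ih => exact .lift A ih
  | liftN A _ ih => exact .lift A ih

theorem PSub.pwf {Γ Γ' : Ctx} {Δ Δ' : PCtx} {σ : Nat → Tm} (h : PSub Γ Δ σ Γ' Δ')
    (hΔ : PWf Γ Δ) : PWf Γ' Δ' := by
  induction h with
  | absent => cases hΔ; assumption
  | present hn _ hm => cases hΔ with | cons hΔ _ => exact .merge hm hΔ hn.toPWf
  | lift _ A h ih => cases hΔ with | cons hΔ hA => exact .cons (ih hΔ) (hA.subst h.toLSub)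
  | liftN A h ih => cases hΔ with | consN hΔ hA => exact .consN (ih hΔ) (hA.subst h.toLSub)

theorem PSub.restr {Γ Γ' : Ctx} {Δ Δ' : PCtx} {σ : Nat → Tm} (h : PSub Γ Δ σ Γ' Δ')
    {t : Srt} (hr : Restr Δ t) : Restr Δ' t := by
  induction h with
  | absent => cases hr; assumption
  | present _ hs hm =>
    cases hr with
    | u hr => rwa [hm.eq_left hs]
    | l => exact .linear _
  | lift _ A _ ih =>
    cases hr with
    | u hr => exact .u (ih hr)
    | l hr => exact .l (ih hr)
  | liftN A _ ih => cases hr with | skip hr => exact .skip (ih hr)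

theorem PSub.has {Γ Γ' : Ctx} {Δ Δ' : PCtx} {σ : Nat → Tm} (h : PSub Γ Δ σ Γ' Δ')
    (hΔ : PWf Γ' Δ') {x : Nat} {s : Srt} {A : Tm} (hx : PHas Δ x s A) :
    PTyped Γ' Δ' (σ x) (subst σ A) := by
  induction h generalizing x A with
  | absent =>
    cases hx with
    | succN hx => rw [subst_inst_succ]; exact .var hΔ hx
  | present hn hs hm =>
    cases hx with
    | zero hr => rw [subst_inst_succ, hm.eq_right hr]; exact hn
    | succU hx =>
      obtain rfl := hm.eq_left hs
      rw [subst_inst_succ]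
      exact .var hΔ hx
  | lift _ B h ih =>
    cases hx with
    | zero hr => rw [subst_up_succ]; exact .var hΔ (.zero (h.restr hr))
    | succU hx =>
      rw [subst_up_succ]
      cases hΔ with
      | cons hΔ hB => exact (ih hΔ hx).rename (.nonlinear hB)
  | liftN B _ ih =>
    cases hx with
    | succN hx =>
      rw [subst_up_succ]
      cases hΔ with
      | consN hΔ hB => exact (ih hΔ hx).rename (.absent hB)

theorem PSub.split {Γ Γ' : Ctx} {Δ Δ' Δa Δb : PCtx} {σ : Nat → Tm} (h : PSub Γ Δ σ Γ' Δ')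
    (hm : Merge Δa Δb Δ) :
    ∃ Δa' Δb', Merge Δa' Δb' Δ' ∧ PSub Γ Δa σ Γ' Δa' ∧ PSub Γ Δb σ Γ' Δb' := by
  induction h generalizing Δa Δb with
  | absent hn => cases hm with | skip hm => exact ⟨_, _, hm, .absent hn, .absent hn⟩
  | present hn hs hm' =>
    cases hm with
    | contra hm =>
      obtain rfl := hm'.eq_left hs
      exact ⟨_, _, hm, .present hn hs (hm.absorb_left hm' hs),
        .present hn hs (hm.symm.absorb_left hm' hs)⟩
    | left hm =>
      obtain ⟨_, h₁, h₂⟩ := hm.right_comm hm'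
      exact ⟨_, _, h₂, .present hn hs h₁, .absent hn.toLTyped⟩
    | right hm =>
      obtain ⟨_, h₁, h₂⟩ := hm.symm.right_comm hm'
      exact ⟨_, _, h₂.symm, .absent hn.toLTyped, .present hn hs h₁⟩
  | lift _ A _ ih =>
    cases hm with
    | contra hm =>
      obtain ⟨_, _, hm', ha, hb⟩ := ih hm
      exact ⟨_, _, .contra hm', .lift _ _ ha, .lift _ _ hb⟩
    | left hm =>
      obtain ⟨_, _, hm', ha, hb⟩ := ih hm
      exact ⟨_, _, .left hm', .lift _ _ ha, .liftN _ hb⟩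
    | right hm =>
      obtain ⟨_, _, hm', ha, hb⟩ := ih hm
      exact ⟨_, _, .right hm', .liftN _ ha, .lift _ _ hb⟩
  | liftN A _ ih =>
    cases hm with
    | skip hm =>
      obtain ⟨_, _, hm', ha, hb⟩ := ih hm
      exact ⟨_, _, .skip hm', .liftN _ ha, .liftN _ hb⟩

theorem PTyped.subst {Γ Γ' : Ctx} {Δ Δ' : PCtx} {σ : Nat → Tm} {m A : Tm}
    (h : PTyped Γ Δ m A) (hσ : PSub Γ Δ σ Γ' Δ') :
    PTyped Γ' Δ' (subst σ m) (subst σ A) := by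
  induction h generalizing Γ' Δ' σ with
  | var h hx => exact hσ.has (hσ.pwf h) hx
  | lam0 t _ hr ih => exact .lam0 t (ih (.liftN _ hσ)) (hσ.restr hr)
  | lam1 t _ hr ih => exact .lam1 t (ih (.lift _ _ hσ)) (hσ.restr hr)
  | app0 _ hn ih => rw [subst_subst1]; exact .app0 (ih hσ) (hn.subst hσ.toLSub)
  | app1 _ _ hm ih₁ ih₂ =>
    obtain ⟨_, _, hm', ha, hb⟩ := hσ.split hm
    rw [subst_subst1]
    exact .app1 (ih₁ ha) (ih₂ hb) hm'
  | conv _ hB hc ih => exact .conv (ih hσ) (hB.subst hσ.toLSub) (hc.subst σ)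

/-- Program 1-substitution. -/
theorem program_one_substitution {Γ : Ctx} {Δ₁ Δ₂ Δ : PCtx} {m n A B : Tm} {s : Srt}
    (h₁ : PTyped (A :: Γ) (some (s, A) :: Δ₁) m B) (h₂ : PTyped Γ Δ₂ n A)
    (hc : Restr Δ₂ s) (hm : Merge Δ₁ Δ₂ Δ) :
    PTyped Γ Δ (subst1 n m) (subst1 n B) := by
  rw [subst1_eq, subst1_eq]
  exact h₁.subst (.present h₂ hc hm)
end TLL
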